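/- Let X be a random variable with X ≥ 0 almost surely, let N ≥ 1 be an integer, and let Z be a random variable with law Gamma(N, N) that is independent of X. Let τ > 0, let ε ∈ (0,1), and let δ ∈ (0,1) satisfy δ − log(1+δ) = (1/N)·log(1/ε). Then P( X ≥ (τ/(1−δ)) · Z ) − ε ≤ P(X ≥ τ) ≤ (1−ε)^{-1} · P( X ≥ (τ/(1+δ)) · Z ). -/

import Mathlib

open MeasureTheory ProbabilityTheory

/-- The Erlang (Gamma with integer shape) measure: `Gamma(k, s)` for `k ≥ 1`, and the
Dirac measure at `0` for `k = 0`. -/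
noncomputable def erlangMeasure (k : ℕ) (s : ℝ) : Measure ℝ :=
  if k = 0 then Measure.dirac 0 else gammaMeasure k s

/-- Chernoff bound for a gamma law of mean one: a set lying on the far side of the threshold `c`
from the mean has mass at most `exp (-a (c - 1 - log c))`. -/
lemma gammaMeasure_le_exp {a c : ℝ} (ha : 0 < a) (hc : 0 < c) {A : Set ℝ} (hA : MeasurableSet A)
    (hAc : ∀ x ∈ A, 0 ≤ (c - 1) * (x - c)) :
    gammaMeasure a a A ≤ ENNReal.ofReal (Real.exp (-(a * (c - 1 - Real.log c)))) := by
  have hpdf : ∀ x ∈ A, gammaPDF a a x ≤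
      ENNReal.ofReal (Real.exp (-(a * (c - 1 - Real.log c)))) * gammaPDF a (a / c) x := by
    intro x hx
    rcases lt_or_ge x 0 with h0 | h0
    · simp [gammaPDF_of_neg h0]
    rw [gammaPDF_of_nonneg h0, gammaPDF_of_nonneg h0, ← ENNReal.ofReal_mul (Real.exp_nonneg _)]
    apply ENNReal.ofReal_le_ofReal
    have hca : Real.exp (a * Real.log c) = c ^ a := by
      rw [Real.rpow_def_of_pos hc, mul_comm]
    have hexp : Real.exp (-(a * x)) ≤ Real.exp (-(a * (c - 1))) * Real.exp (-(a / c * x)) := by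
      rw [← Real.exp_add, Real.exp_le_exp]
      have h : 0 ≤ a / c * ((c - 1) * (x - c)) := mul_nonneg (by positivity) (hAc x hx)
      have h' : a / c * ((c - 1) * (x - c)) = a * x - a * (c - 1) - a / c * x := by
        field_simp
        ring
      linarith
    have hΓ : 0 < Real.Gamma a := Real.Gamma_pos_of_pos ha
    calc a ^ a / Real.Gamma a * x ^ (a - 1) * Real.exp (-(a * x))
        ≤ a ^ a / Real.Gamma a * x ^ (a - 1) *
          (Real.exp (-(a * (c - 1))) * Real.exp (-(a / c * x))) := by gcongr
      _ = Real.exp (-(a * (c - 1 - Real.log c))) *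
          ((a / c) ^ a / Real.Gamma a * x ^ (a - 1) * Real.exp (-(a / c * x))) := by
        have hsplit : -(a * (c - 1 - Real.log c)) = -(a * (c - 1)) + a * Real.log c := by ring
        rw [hsplit, Real.exp_add, hca, Real.div_rpow ha.le hc.le]
        have : 0 < c ^ a := by positivity
        field_simp
  have hmeas : Measurable (gammaPDF a (a / c)) := (measurable_gammaPDFReal a (a / c)).ennreal_ofReal
  calc gammaMeasure a a A = ∫⁻ x in A, gammaPDF a a x := withDensity_apply _ hA
    _ ≤ ∫⁻ x in A, ENNReal.ofReal (Real.exp (-(a * (c - 1 - Real.log c)))) *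
          gammaPDF a (a / c) x := setLIntegral_mono (hmeas.const_mul _) hpdf
    _ ≤ ∫⁻ x, ENNReal.ofReal (Real.exp (-(a * (c - 1 - Real.log c)))) *
          gammaPDF a (a / c) x := setLIntegral_le_lintegral _ _
    _ = ENNReal.ofReal (Real.exp (-(a * (c - 1 - Real.log c)))) := by
      rw [lintegral_const_mul _ hmeas, lintegral_gammaPDF_eq_one ha (by positivity), mul_one]

lemma two_mul_le_log_one_add_sub_log_one_sub {x : ℝ} (h0 : 0 ≤ x) (h1 : x < 1) :
    2 * x ≤ Real.log (1 + x) - Real.log (1 - x) := by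
  have h := Real.hasSum_log_sub_log_of_abs_lt_one (by rwa [abs_of_nonneg h0])
  simpa using le_hasSum h 0 fun k _ ↦ by positivity

theorem ccdf_erlang_sandwich_bounds {Ω : Type*} [MeasureSpace Ω]
    [IsProbabilityMeasure (ℙ : Measure Ω)]
    (X : Ω → ℝ) (hX : Measurable X) (hX0 : ∀ᵐ ω, 0 ≤ X ω)
    (N : ℕ) (hN : 1 ≤ N) (Z : Ω → ℝ) (hZ : Measurable Z)
    (hZlaw : Measure.map Z ℙ = erlangMeasure N N)
    (hindep : IndepFun X Z ℙ)
    (τ : ℝ) (hτ : 0 < τ) (ε : ℝ) (hε0 : 0 < ε) (hε1 : ε < 1)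
    (δ : ℝ) (hδ0 : 0 < δ) (hδ1 : δ < 1)
    (hδ : δ - Real.log (1 + δ) = (1 / N) * Real.log (1 / ε)) :
    (ℙ {ω | τ / (1 - δ) * Z ω ≤ X ω}).toReal - ε ≤ (ℙ {ω | τ ≤ X ω}).toReal ∧
    (ℙ {ω | τ ≤ X ω}).toReal ≤ (1 - ε)⁻¹ * (ℙ {ω | τ / (1 + δ) * Z ω ≤ X ω}).toReal := by
  have hN0 : (0 : ℝ) < N := by exact_mod_cast hN
  have hNδ : N * (δ - Real.log (1 + δ)) = -Real.log ε := by
    rw [hδ, one_div ε, Real.log_inv]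
    field_simp
  have htail : ∀ {c : ℝ} {A : Set ℝ}, 0 < c → MeasurableSet A →
      (∀ x ∈ A, 0 ≤ (c - 1) * (x - c)) → δ - Real.log (1 + δ) ≤ c - 1 - Real.log c →
      Measure.real ℙ (Z ⁻¹' A) ≤ ε := by
    intro c A hc hA hAc hle
    have h := gammaMeasure_le_exp hN0 hc hA hAc
    rw [erlangMeasure, if_neg (by omega)] at hZlaw
    rw [← hZlaw, Measure.map_apply hZ hA] at h
    calc Measure.real ℙ (Z ⁻¹' A) ≤ Real.exp (-(N * (c - 1 - Real.log c))) :=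
          ENNReal.toReal_le_of_le_ofReal (Real.exp_nonneg _) h
      _ ≤ Real.exp (Real.log ε) := by
        rw [Real.exp_le_exp]
        nlinarith [mul_le_mul_of_nonneg_left hle hN0.le]
      _ = ε := Real.exp_log hε0
  have hlower : Measure.real ℙ (Z ⁻¹' Set.Iic (1 - δ)) ≤ ε := by
    refine htail (sub_pos.2 hδ1) measurableSet_Iic (fun x hx ↦ ?_) ?_
    · exact mul_nonneg_of_nonpos_of_nonpos (by linarith) (sub_nonpos.2 hx)
    · linarith [two_mul_le_log_one_add_sub_log_one_sub hδ0.le hδ1]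
  have hupper : Measure.real ℙ (Z ⁻¹' Set.Ici (1 + δ)) ≤ ε := by
    refine htail (c := 1 + δ) (by linarith) measurableSet_Ici (fun x hx ↦ ?_) (by linarith)
    exact mul_nonneg (by linarith) (sub_nonneg.2 hx)
  constructor
  · have hsub : {ω | τ / (1 - δ) * Z ω ≤ X ω} ⊆ {ω | τ ≤ X ω} ∪ Z ⁻¹' Set.Iic (1 - δ) := by
      intro ω hω
      by_contra! h
      simp only [Set.mem_union, Set.mem_ofPred_eq, Set.mem_preimage, Set.mem_Iic, not_or,
        not_le] at h hω
      have h1 : τ / (1 - δ) * (1 - δ) = τ := div_mul_cancel₀ _ (by linarith)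
      have h2 := mul_le_mul_of_nonneg_left h.2.le (div_pos hτ (sub_pos.2 hδ1)).le
      linarith [h.1]
    have h := (measureReal_mono (μ := ℙ) hsub).trans (measureReal_union_le _ _)
    simp only [Measure.real] at h hlower
    linarith
  · have hsub : X ⁻¹' Set.Ici τ ∩ Z ⁻¹' Set.Iio (1 + δ) ⊆ {ω | τ / (1 + δ) * Z ω ≤ X ω} := by
      rintro ω ⟨h1, h2⟩
      simp only [Set.mem_preimage, Set.mem_Ici, Set.mem_Iio] at h1 h2
      have h3 : τ / (1 + δ) * (1 + δ) = τ := div_mul_cancel₀ _ (by linarith)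
      have h4 := mul_le_mul_of_nonneg_left h2.le (div_pos hτ (by linarith : 0 < 1 + δ)).le
      simp only [Set.mem_ofPred_eq]
      linarith
    have hcompl : 1 - ε ≤ Measure.real ℙ (Z ⁻¹' Set.Iio (1 + δ)) := by
      have h := probReal_compl_eq_one_sub (μ := (ℙ : Measure Ω))
        (hZ (measurableSet_Ici (a := 1 + δ)))
      rw [← Set.preimage_compl, Set.compl_Ici] at h
      linarith
    have h := measureReal_mono (μ := ℙ) hsub
    rw [measureReal_def, hindep.measure_inter_preimage_eq_mul _ _ measurableSet_Ici
      measurableSet_Iio, ENNReal.toReal_mul] at h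
    rw [le_inv_mul_iff₀ (sub_pos.2 hε1), mul_comm]
    exact (mul_le_mul_of_nonneg_left hcompl ENNReal.toReal_nonneg).trans h
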